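/- There is no 48 × 13 binary 5-covering array; consequently CAN(5,13,2) ≥ 49. -/

import Mathlib

/-- An `m × n` matrix over `B_q = {0,…,q-1}` is a `t`-covering array if for any `t`
distinct column indices and any `q`-ary vector of length `t`, some row realizes it. -/
def IsCoveringArray (m n q t : ℕ) (C : Fin m → Fin n → Fin q) : Prop :=
  ∀ cols : Fin t → Fin n, Function.Injective cols →
    ∀ v : Fin t → Fin q, ∃ r : Fin m, ∀ j : Fin t, C r (cols j) = v j

/-- `CAN t n q` : the minimal size `m` for which a `CA(m; t, n, q)` exists. -/
noncomputable def CAN (t n q : ℕ) : ℕ :=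
  sInf { m | ∃ C : Fin m → Fin n → Fin q, IsCoveringArray m n q t C }

/-- The weight of the `i`-th column: the number of nonzero entries. -/
def colWt {m n q : ℕ} (C : Fin m → Fin n → Fin q) (i : Fin n) : ℕ :=
  (Finset.univ.filter fun r : Fin m => (C r i : ℕ) ≠ 0).card

/-- The support of the `i`-th column: the set of coordinates where it is nonzero. -/
def colSupp {m n q : ℕ} (C : Fin m → Fin n → Fin q) (i : Fin n) : Finset (Fin m) :=
  Finset.univ.filter fun r : Fin m => (C r i : ℕ) ≠ 0

/-- The Hamming distance between the `i`-th and `j`-th columns. -/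
def colDist {m n q : ℕ} (C : Fin m → Fin n → Fin q) (i j : Fin n) : ℕ :=
  (Finset.univ.filter fun r : Fin m => C r i ≠ C r j).card

/-- Two arrays are equivalent if one is obtained from the other by a row permutation,
a column permutation, and value permutations applied columnwise. -/
def CAEquiv {m n q : ℕ} (C C' : Fin m → Fin n → Fin q) : Prop :=
  ∃ (σ : Equiv.Perm (Fin m)) (τ : Equiv.Perm (Fin n)) (f : Fin n → Equiv.Perm (Fin q)),
    ∀ r i, C' r i = f i (C (σ r) (τ i))

/-- The standard maximal binary 2-covering array of size `m` : an
`m × (m-1).choose (m/2 - 1)` binary matrix whose first row is all ones and whose columns,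
restricted to the remaining `m - 1` rows, are exactly (i.e. are pairwise distinct) the binary
vectors of length `m-1` with `m/2 - 1` ones. -/
def IsStandardMaxArray (m : ℕ) (S : Fin m → Fin ((m-1).choose (m/2 - 1)) → Fin 2) : Prop :=
  (∀ (r : Fin m) (i), (r : ℕ) = 0 → S r i = 1) ∧
  (Function.Injective fun i => fun r => S r i) ∧
  (∀ i, (Finset.univ.filter fun r : Fin m => (r : ℕ) ≠ 0 ∧ S r i = 1).card = m/2 - 1)

/-- A binary 2-covering array with ten columns has at least six rows, and if it has exactly six then
all its columns are balanced: the supports of the columns and their complements form an antichain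
of 20 sets. -/
theorem six_le_card_and_balanced {α ι : Type*} [Fintype α] [DecidableEq α] [Fintype ι]
    [DecidableEq ι] (hι : Fintype.card ι = 10) (C : α → ι → Fin 2)
    (hC : ∀ i j, i ≠ j → ∀ v w, ∃ r, C r i = v ∧ C r j = w) :
    6 ≤ Fintype.card α ∧
      (Fintype.card α = 6 → ∀ i v, (Finset.univ.filter fun r => C r i = v).card = 3) := by
  set F : ι × Fin 2 → Finset α := fun p => Finset.univ.filter fun r => C r p.1 = p.2 with hF
  have hsub : ∀ p q, p ≠ q → ¬ F p ⊆ F q := by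
    rintro ⟨i, v⟩ ⟨j, w⟩ hne hs
    obtain ⟨r, hr1, hr2⟩ : ∃ r, C r i = v ∧ C r j ≠ w := by
      by_cases hij : i = j
      · subst hij
        have : Nontrivial ι := Fintype.one_lt_card_iff_nontrivial.1 (by omega)
        obtain ⟨k, hk⟩ := exists_ne i
        obtain ⟨r, hr, -⟩ := hC i k hk.symm v 0
        exact ⟨r, hr, fun h => hne (by rw [← hr, ← h])⟩
      · obtain ⟨r, hr, hr'⟩ := hC i j hij v (1 - w)
        refine ⟨r, hr, ?_⟩
        rw [hr']
        exact (by decide : ∀ w : Fin 2, 1 - w ≠ w) w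
    have := hs (show r ∈ F (i, v) by simp [hF, hr1])
    simp [hF, hr2] at this
  have hinj : Function.Injective F := fun p q h => by
    by_contra hne
    exact hsub p q hne h.subset
  have hanti : IsAntichain (· ⊆ ·) ((Finset.univ.image F : Finset (Finset α)) : Set (Finset α)) := by
    intro A hA B hB hAB
    simp only [Finset.coe_image, Finset.coe_univ, Set.image_univ, Set.mem_range] at hA hB
    obtain ⟨p, rfl⟩ := hA
    obtain ⟨q, rfl⟩ := hB
    exact hsub p q fun h => hAB (by rw [h])
  have hlym := Finset.lubell_yamamoto_meshalkin_inequality_sum_inv_choose (𝕜 := ℚ) hanti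
  rw [Finset.sum_image hinj.injOn] at hlym
  have hcard : (Finset.univ : Finset (ι × Fin 2)).card = 20 := by simp [hι]
  have hle : ∀ p, (F p).card ≤ Fintype.card α := fun p => Finset.card_le_univ _
  constructor
  · by_contra! hlt
    have hlow : ∀ p ∈ (Finset.univ : Finset (ι × Fin 2)),
        (1 / 10 : ℚ) ≤ ((Fintype.card α).choose (F p).card : ℚ)⁻¹ := by
      intro p _
      have h := hle p
      generalize (F p).card = k at h ⊢
      generalize Fintype.card α = m at h hlt ⊢
      interval_cases m <;> interval_cases k <;> norm_num [Nat.choose]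
    have := Finset.card_nsmul_le_sum _ _ _ hlow
    rw [hcard] at this
    norm_num at this
    linarith
  · intro h6 i v
    rw [h6] at hlym
    have hlow : ∀ p, (1 / 20 : ℚ) ≤ ((6 : ℕ).choose (F p).card : ℚ)⁻¹ := by
      intro p
      have h := hle p
      rw [h6] at h
      generalize (F p).card = k at h ⊢
      interval_cases k <;> norm_num [Nat.choose]
    have hsum : ∑ _p : ι × Fin 2, (1 / 20 : ℚ) = 1 := by
      rw [Finset.sum_const, hcard]; norm_num
    have heq := (Finset.sum_eq_sum_iff_of_le fun p _ => hlow p).1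
      (le_antisymm (Finset.sum_le_sum fun p _ => hlow p) (hlym.trans hsum.ge)) (i, v)
      (Finset.mem_univ _)
    have h := hle (i, v)
    rw [h6] at h
    change (F (i, v)).card = 3
    generalize (F (i, v)).card = k at h heq ⊢
    interval_cases k <;> first | rfl | norm_num [Nat.choose] at heq

section

variable {C : Fin 48 → Fin 13 → Fin 2}

/-- The rows of an array showing the pattern `u` in the columns `c`. -/
def fiberRows (C : Fin 48 → Fin 13 → Fin 2) (c : Fin 3 → Fin 13) (u : Fin 3 → Fin 2) :
    Finset (Fin 48) :=
  Finset.univ.filter fun r => (fun j => C r (c j)) = u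

theorem derived_array (hC : IsCoveringArray 48 13 2 5 C) {c : Fin 3 → Fin 13}
    (hc : Function.Injective c) (u : Fin 3 → Fin 2) :
    6 ≤ (fiberRows C c u).card ∧ ((fiberRows C c u).card = 6 → ∀ d, d ∉ Set.range c → ∀ v,
      ((fiberRows C c u).filter fun r => C r d = v).card = 3) := by
  have key := six_le_card_and_balanced (α := fiberRows C c u)
    (ι := {i : Fin 13 // i ∉ Finset.univ.image c}) (by
      rw [Fintype.card_subtype_compl, Fintype.card_coe, Finset.card_image_of_injective _ hc]
      rfl)
    (fun r i => C r i) (by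
      rintro ⟨i, hi⟩ ⟨j, hj⟩ hij v w
      have hi' : ∀ k, c k ≠ i := by simpa using hi
      have hj' : ∀ k, c k ≠ j := by simpa using hj
      have hij' : j ≠ i := fun h => hij (by simp [h])
      obtain ⟨r, hr⟩ := hC (Fin.cons j (Fin.cons i c))
        (Fin.cons_injective_iff.2 ⟨by
          rintro ⟨k, hk⟩
          induction k using Fin.cases with
          | zero => exact hij' hk.symm
          | succ k => exact hj' k hk,
          Fin.cons_injective_iff.2 ⟨by rintro ⟨k, hk⟩; exact hi' k hk, hc⟩⟩)
        (Fin.cons w (Fin.cons v u))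
      exact ⟨⟨r, by
        simpa [fiberRows] using funext fun k : Fin 3 => hr k.succ.succ⟩, hr 1, hr 0⟩)
  rw [Fintype.card_coe] at key
  refine ⟨key.1, fun h6 d hd v => ?_⟩
  rw [← key.2 h6 ⟨d, by simpa using hd⟩ v]
  rw [Finset.univ_eq_attach, Finset.filter_attach (fun r => C r d = v)]
  simp

theorem card_fiberRows (hC : IsCoveringArray 48 13 2 5 C) {c : Fin 3 → Fin 13}
    (hc : Function.Injective c) (u : Fin 3 → Fin 2) : (fiberRows C c u).card = 6 := by
  have hsum : ∑ u : Fin 3 → Fin 2, 6 = ∑ u, (fiberRows C c u).card := by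
    have := Finset.card_eq_sum_card_fiberwise (s := (Finset.univ : Finset (Fin 48)))
      (t := (Finset.univ : Finset (Fin 3 → Fin 2))) (f := fun r j => C r (c j)) (by simp)
    simp only [fiberRows]
    rw [← this]
    simp
  exact ((Finset.sum_eq_sum_iff_of_le fun u _ => (derived_array hC hc u).1).1 hsum u
    (Finset.mem_univ _)).symm

/-- The value `±1` attached to a binary symbol. -/
def binSign (v : Fin 2) : ℤ := if v = 0 then 1 else -1

theorem binSign_mul_self (v : Fin 2) : binSign v * binSign v = 1 := by
  unfold binSign; split_ifs <;> rfl

theorem sum_mul_binSign_eq_zero (hC : IsCoveringArray 48 13 2 5 C) {c : Fin 3 → Fin 13}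
    (hc : Function.Injective c) {d : Fin 13} (hd : d ∉ Set.range c) (g : (Fin 3 → Fin 2) → ℤ) :
    ∑ r, g (fun j => C r (c j)) * binSign (C r d) = 0 := by
  rw [← Finset.sum_fiberwise (s := Finset.univ) (g := fun r j => C r (c j))]
  refine Finset.sum_eq_zero fun u _ => ?_
  have hbal := (derived_array hC hc u).2 (card_fiberRows hC hc u) d hd
  change ∑ r ∈ fiberRows C c u, _ = 0
  have hg : ∀ r ∈ fiberRows C c u, g (fun j => C r (c j)) * binSign (C r d)
      = g u * binSign (C r d) := by
    intro r hr
    rw [(Finset.mem_filter.1 hr).2]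
  rw [Finset.sum_congr rfl hg, ← Finset.mul_sum,
    ← Finset.sum_fiberwise (s := fiberRows C c u) (g := fun r => C r d), Fin.sum_univ_two]
  have hv : ∀ v, ∑ r ∈ fiberRows C c u with C r d = v, binSign (C r d) = 3 * binSign v := by
    intro v
    rw [Finset.sum_congr rfl fun r hr => by rw [(Finset.mem_filter.1 hr).2], Finset.sum_const,
      hbal v]
    simp
  rw [hv, hv]
  simp [binSign]

theorem sum_four_eq_zero (hC : IsCoveringArray 48 13 2 5 C) {a b c d : Fin 13} (hab : a ≠ b)
    (hda : d ≠ a) (hdb : d ≠ b) (hdc : d ≠ c) :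
    ∑ r, binSign (C r a) * binSign (C r b) * binSign (C r c) * binSign (C r d) = 0 := by
  obtain ⟨z, hza, hzb, hzd⟩ : ∃ z, z ≠ a ∧ z ≠ b ∧ z ≠ d := by
    have : ∃ z, z ∉ ({a, b, d} : Finset (Fin 13)) := by
      by_contra! h
      have h1 := Finset.card_le_card (fun x _ => h x : (Finset.univ : Finset (Fin 13)) ⊆ _)
      have h2 := Finset.card_le_three (a := a) (b := b) (c := d)
      simp only [Finset.card_univ, Fintype.card_fin] at h1
      omega
    simpa using this
  have main : ∀ e, e ≠ a → e ≠ b → e ≠ d → ∀ g : (Fin 3 → Fin 2) → ℤ,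
      ∑ r, g (fun j => C r (![a, b, e] j)) * binSign (C r d) = 0 := by
    intro e hea heb hed g
    refine sum_mul_binSign_eq_zero hC ?_ ?_ g
    · intro x y h
      fin_cases x <;> fin_cases y <;> simp_all [eq_comm]
    · rintro ⟨k, hk⟩
      fin_cases k <;> simp_all [eq_comm]
  by_cases hca : c = a
  · subst hca
    exact main z hza hzb hzd fun u => binSign (u 0) * binSign (u 1) * binSign (u 0)
  by_cases hcb : c = b
  · subst hcb
    exact main z hza hzb hzd fun u => binSign (u 0) * binSign (u 1) * binSign (u 1)
  exact main c hca hcb hdc.symm fun u => binSign (u 0) * binSign (u 1) * binSign (u 2)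

/-- The product of the signs of a row in two columns. -/
def pairSign (C : Fin 48 → Fin 13 → Fin 2) (p : Fin 13 × Fin 13) (r : Fin 48) : ℤ :=
  binSign (C r p.1) * binSign (C r p.2)

theorem pairSign_mul_self (p : Fin 13 × Fin 13) (r : Fin 48) :
    pairSign C p r * pairSign C p r = 1 := by
  rw [pairSign, mul_mul_mul_comm, binSign_mul_self, binSign_mul_self, one_mul]

theorem sum_pairSign_mul_eq_zero (hC : IsCoveringArray 48 13 2 5 C) {p q : Fin 13 × Fin 13}
    (hp : p.1 < p.2) (hq : q.1 < q.2) (hpq : p ≠ q) :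
    ∑ r, pairSign C p r * pairSign C q r = 0 := by
  obtain ⟨a, b⟩ := p
  obtain ⟨c, d⟩ := q
  simp only [pairSign] at hp hq ⊢
  by_cases hd : d ≠ a ∧ d ≠ b
  · rw [← sum_four_eq_zero hC hp.ne hd.1 hd.2 hq.ne']
    exact Finset.sum_congr rfl fun r _ => by ring
  · have hca : c ≠ a := by
      rintro rfl
      refine hd ⟨hq.ne', ?_⟩
      rintro rfl
      exact hpq rfl
    have hcb : c ≠ b := by
      rintro rfl
      exact hd ⟨(hp.trans hq).ne', hq.ne'⟩
    rw [← sum_four_eq_zero hC hp.ne hca hcb hq.ne]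
    exact Finset.sum_congr rfl fun r _ => by ring

theorem not_isCoveringArray_48_13 : ¬ IsCoveringArray 48 13 2 5 C := by
  intro hC
  set P : Finset (Fin 13 × Fin 13) := Finset.univ.filter fun p => p.1 < p.2 with hP
  have hcard : P.card = 78 := by decide +kernel
  have htotal : ∑ r, (∑ p ∈ P, pairSign C p 0 * pairSign C p r) ^ 2 = 78 * 48 := by
    calc ∑ r, (∑ p ∈ P, pairSign C p 0 * pairSign C p r) ^ 2
        = ∑ p ∈ P, ∑ q ∈ P, pairSign C p 0 * pairSign C q 0 *
            ∑ r, pairSign C p r * pairSign C q r := by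
          simp_rw [sq, Finset.sum_mul_sum, Finset.mul_sum]
          rw [Finset.sum_comm]
          refine Finset.sum_congr rfl fun p _ => ?_
          rw [Finset.sum_comm]
          exact Finset.sum_congr rfl fun q _ => Finset.sum_congr rfl fun r _ => by ring
      _ = ∑ p ∈ P, 48 := by
          refine Finset.sum_congr rfl fun p hp => ?_
          rw [Finset.sum_eq_single_of_mem p hp]
          · simp [pairSign_mul_self]
          · intro q hq hqp
            rw [sum_pairSign_mul_eq_zero hC (Finset.mem_filter.1 hp).2
              (Finset.mem_filter.1 hq).2 hqp.symm, mul_zero]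
      _ = 78 * 48 := by simp [hcard]
  have hrow := Finset.single_le_sum
    (f := fun r => (∑ p ∈ P, pairSign C p 0 * pairSign C p r) ^ 2)
    (fun r _ => sq_nonneg _) (Finset.mem_univ (0 : Fin 48))
  simp only [htotal, pairSign_mul_self, Finset.sum_const, hcard] at hrow
  norm_num at hrow

end

/-- Repeating a row preserves the covering property. -/
theorem IsCoveringArray.mono_rows {m m' n q t : ℕ} {C : Fin m → Fin n → Fin q} (hm : 0 < m)
    (h : m ≤ m') (hC : IsCoveringArray m n q t C) :
    ∃ C' : Fin m' → Fin n → Fin q, IsCoveringArray m' n q t C' := by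
  refine ⟨fun r => if hr : (r : ℕ) < m then C ⟨r, hr⟩ else C ⟨0, hm⟩, fun cols hcols v => ?_⟩
  obtain ⟨r, hr⟩ := hC cols hcols v
  exact ⟨Fin.castLE h r, by simpa using hr⟩

theorem exists_isCoveringArray (t n q : ℕ) [NeZero q] :
    ∃ m, ∃ C : Fin m → Fin n → Fin q, IsCoveringArray m n q t C := by
  refine ⟨Fintype.card (Fin n → Fin q), (Fintype.equivFin _).symm, fun cols hcols v => ?_⟩
  exact ⟨Fintype.equivFin _ (Function.extend cols v 0), fun j => by simp [hcols.extend_apply]⟩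

/-- there is no `48 × 13` binary 5-covering array; consequently
`CAN(5,13,2) ≥ 49`. -/
theorem no_48_by_13 :
    (∀ C : Fin 48 → Fin 13 → Fin 2, ¬ IsCoveringArray 48 13 2 5 C) ∧
    49 ≤ CAN 5 13 2 := by
  refine ⟨fun C => not_isCoveringArray_48_13, ?_⟩
  refine le_csInf (exists_isCoveringArray 5 13 2) ?_
  rintro m ⟨C, hC⟩
  by_contra! hlt
  have hm : 0 < m := by
    obtain ⟨r, -⟩ := hC (Fin.castLE (by norm_num)) (Fin.castLE_injective _) 0
    exact r.pos
  obtain ⟨C', hC'⟩ := hC.mono_rows hm (Nat.le_of_lt_succ hlt)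
  exact not_isCoveringArray_48_13 hC'
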